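/- Fix real numbers α and θ with 0 < α < 1 and θ > −α, and let (ω_m)_{m ∈ ℕ} be a sequence in ℕ₀ with ω_m/m^{α} → ∞ as m → ∞. Then for every n ∈ ℕ and k ∈ ℕ₀, lim_{m→∞} d_{n,k}^{m,ω_m} / d^{m,ω_m} = 0. (Key claim in the proof of Proposition 2.3(c), ruling out regular paths with superpolynomial feature growth.) -/

import Mathlib

open scoped BigOperators
open Filter

/-- Rising factorial `(x)_{j↑} = x(x+1)⋯(x+j-1)`. -/
noncomputable def risingFac (x : ℝ) (j : ℕ) : ℝ :=
  ∏ i ∈ Finset.range j, (x + i)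

/-- Falling factorial `(x)_{j↓} = x(x-1)⋯(x-j+1)`. -/
noncomputable def fallingFac (x : ℝ) (j : ℕ) : ℝ :=
  ∏ i ∈ Finset.range j, (x - i)

/-- `S_{n,m} = Σ_{i=1}^{m−n} (α+θ)_{m−i↑} (θ+m−1)_{i−1↓}`. -/
noncomputable def Scot (α θ : ℝ) (n m : ℕ) : ℝ :=
  ∑ i ∈ Finset.Icc 1 (m - n),
    risingFac (α + θ) (m - i) * fallingFac (θ + (m : ℝ) - 1) (i - 1)

/-- `d_{n,k}^{m,l} = C(l,k) ((θ+n)_{m−n↑})^k (S_{n,m})^{l−k}` (equal to `0` when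
`k > l`, since then the binomial coefficient vanishes). -/
noncomputable def dcot (α θ : ℝ) (n k m l : ℕ) : ℝ :=
  (Nat.choose l k : ℝ) * (risingFac (θ + (n : ℝ)) (m - n)) ^ k *
    (Scot α θ n m) ^ (l - k)

/-- `d^{m,l} = ((θ+1)_{m−1↑} + S_{1,m})^l`. -/
noncomputable def dtot (α θ : ℝ) (m l : ℕ) : ℝ :=
  (risingFac (θ + 1) (m - 1) + Scot α θ 1 m) ^ l

theorem risingFac_succ (x : ℝ) (j : ℕ) : risingFac x (j + 1) = risingFac x j * (x + j) :=
  Finset.prod_range_succ _ _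

theorem risingFac_add (x : ℝ) (i j : ℕ) :
    risingFac x (i + j) = risingFac x i * risingFac (x + i) j := by
  simp [risingFac, Finset.prod_range_add, add_assoc]

theorem risingFac_pos {x : ℝ} (hx : 0 < x) (j : ℕ) : 0 < risingFac x j :=
  Finset.prod_pos fun i _ => by positivity

theorem fallingFac_succ' (x : ℝ) (j : ℕ) :
    fallingFac x (j + 1) = x * fallingFac (x - 1) j := by
  rw [fallingFac, Finset.prod_range_succ', mul_comm]
  simp [fallingFac, sub_sub, add_comm]

theorem Scot_self (α θ : ℝ) (n : ℕ) : Scot α θ n n = 0 := by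
  simp [Scot]

theorem Scot_eq_sum_range (α θ : ℝ) (n m : ℕ) :
    Scot α θ n m = ∑ i ∈ Finset.range (m - n),
      risingFac (α + θ) (m - (i + 1)) * fallingFac (θ + (m : ℝ) - 1) i := by
  rw [Scot, ← Finset.Ico_add_one_right_eq_Icc, Finset.sum_Ico_eq_sum_range]
  simp [add_comm]

theorem Scot_succ (α θ : ℝ) {n m : ℕ} (h : n ≤ m) :
    Scot α θ n (m + 1) = (θ + m) * Scot α θ n m + risingFac (α + θ) m := by
  rw [Scot_eq_sum_range, Scot_eq_sum_range, Nat.sub_add_comm h, Finset.sum_range_succ',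
    Finset.mul_sum]
  congr 1
  · refine Finset.sum_congr rfl fun i _ => ?_
    rw [fallingFac_succ', Nat.add_sub_add_right]
    push_cast
    rw [show θ + ((m : ℝ) + 1) - 1 = θ + m by ring]
    ring
  · simp [fallingFac]

/-- The ratio `(α+θ)_{m↑} / (θ+1)_{m-1↑}`, whose increments are, up to the factor `α`, the
normalized summands of `Scot`. -/
noncomputable def risingRatio (α θ : ℝ) (m : ℕ) : ℝ :=
  risingFac (α + θ) m / risingFac (θ + 1) (m - 1)

section

variable {α θ : ℝ}

theorem risingRatio_one : risingRatio α θ 1 = α + θ := by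
  simp [risingRatio, risingFac]

theorem risingRatio_succ {m : ℕ} (hm : 1 ≤ m) :
    risingRatio α θ (m + 1) = risingRatio α θ m * ((α + θ + m) / (θ + m)) := by
  obtain ⟨m, rfl⟩ := Nat.exists_eq_add_of_le' hm
  simp only [risingRatio, Nat.add_sub_cancel, risingFac_succ _ (m + 1), risingFac_succ (θ + 1) m]
  rw [mul_div_mul_comm]
  push_cast
  ring_nf

theorem risingRatio_pos (hα1 : α < 1) (hθ : -α < θ) (m : ℕ) : 0 < risingRatio α θ m :=
  div_pos (risingFac_pos (by linarith) _) (risingFac_pos (by linarith) _)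

theorem risingRatio_mono (hα0 : 0 < α) (hα1 : α < 1) (hθ : -α < θ) {n m : ℕ} (hn : 1 ≤ n)
    (h : n ≤ m) : risingRatio α θ n ≤ risingRatio α θ m := by
  induction m, h using Nat.le_induction with
  | base => rfl
  | succ m h ih =>
    refine ih.trans ?_
    have hm : (1 : ℝ) ≤ m := by exact_mod_cast hn.trans h
    rw [risingRatio_succ (hn.trans h)]
    refine le_mul_of_one_le_right (risingRatio_pos hα1 hθ m).le ?_
    rw [one_le_div (by linarith)]
    linarith

theorem Scot_eq (hα0 : 0 < α) (hα1 : α < 1) (hθ : -α < θ) {n m : ℕ} (hn : 1 ≤ n) (h : n ≤ m) :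
    Scot α θ n m =
      risingFac (θ + 1) (m - 1) * ((risingRatio α θ m - risingRatio α θ n) / α) := by
  induction m, h using Nat.le_induction with
  | base => simp [Scot_self]
  | succ m h ih =>
    have hm1 := hn.trans h
    have hm : (1 : ℝ) ≤ m := by exact_mod_cast hm1
    have hpos : 0 < θ + m := by linarith
    have hR : risingFac (α + θ) m = risingRatio α θ m * risingFac (θ + 1) (m - 1) :=
      (div_mul_cancel₀ _ (risingFac_pos (by linarith) _).ne').symm
    have hP : risingFac (θ + 1) m = risingFac (θ + 1) (m - 1) * (θ + m) := by
      conv_lhs => rw [← Nat.sub_add_cancel hm1, risingFac_succ]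
      rw [Nat.cast_sub hm1]
      push_cast
      ring
    rw [Scot_succ _ _ h, ih, risingRatio_succ hm1, hR, Nat.add_sub_cancel, hP]
    field_simp
    ring

theorem one_add_div_le_rpow (hα0 : 0 < α) (hα1 : α < 1) {x : ℝ} (hx : 0 < x) :
    (x + 1) / (x + 1 - α) ≤ ((x + 1) / x) ^ α := by
  have hB := rpow_one_add_le_one_add_mul_self (s := -1 / (x + 1)) (p := α)
    (by rw [le_div_iff₀ (by linarith)]; linarith) hα0.le hα1.le
  rw [show 1 + -1 / (x + 1) = ((x + 1) / x)⁻¹ by field_simp; ring,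
    Real.inv_rpow (by positivity)] at hB
  rw [show (x + 1) / (x + 1 - α) = (1 + α * (-1 / (x + 1)))⁻¹ by
    rw [← inv_div]; congr 1; field_simp; ring]
  exact inv_le_of_inv_le₀ (by positivity) hB

theorem risingRatio_le_rpow (hα0 : 0 < α) (hα1 : α < 1) (hθ : -α < θ) {m : ℕ} (hm : 1 ≤ m) :
    risingRatio α θ m ≤ (α + θ) * ((α + θ + (m - 1)) / (α + θ)) ^ α := by
  have h0 : 0 < α + θ := by linarith
  induction m, hm using Nat.le_induction with
  | base => simp [risingRatio_one, h0.ne']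
  | succ m hm ih =>
    have hm' : (1 : ℝ) ≤ m := by exact_mod_cast hm
    have hx : 0 < α + θ + (m - 1) := by linarith
    have key := one_add_div_le_rpow hα0 hα1 hx
    rw [show α + θ + ((m : ℝ) - 1) + 1 = α + θ + m by ring,
      show α + θ + (m : ℝ) - α = θ + m by ring] at key
    rw [risingRatio_succ hm]
    calc _ ≤ (α + θ) * ((α + θ + (m - 1)) / (α + θ)) ^ α *
          ((α + θ + m) / (α + θ + (m - 1))) ^ α :=
          mul_le_mul ih key (div_nonneg (by linarith) (by linarith)) (by positivity)
      _ = _ := by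
          rw [mul_assoc, ← Real.mul_rpow (by positivity) (by positivity)]
          push_cast
          congr 2
          field_simp
          ring

theorem exists_risingRatio_le (hα0 : 0 < α) (hα1 : α < 1) (hθ : -α < θ) :
    ∃ C : ℝ, 0 < C ∧ ∀ m : ℕ, 1 ≤ m → risingRatio α θ m ≤ C * (m : ℝ) ^ α := by
  have h0 : 0 < α + θ := by linarith
  refine ⟨(α + θ) * ((α + θ + 1) / (α + θ)) ^ α, by positivity, fun m hm => ?_⟩
  have hm' : (1 : ℝ) ≤ m := by exact_mod_cast hm
  refine (risingRatio_le_rpow hα0 hα1 hθ hm).trans ?_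
  rw [mul_assoc, ← Real.mul_rpow (by positivity) (by positivity)]
  have hx : 0 ≤ α + θ + ((m : ℝ) - 1) := by linarith
  have hle : (α + θ + ((m : ℝ) - 1)) / (α + θ) ≤ (α + θ + 1) / (α + θ) * m := by
    rw [div_mul_eq_mul_div]
    gcongr
    nlinarith
  gcongr

end

theorem choose_mul_pow_div_pow_le {c δ D : ℝ} (hc : 0 ≤ c) (hδ : 0 < δ) (hD : δ ≤ D) {k l : ℕ}
    (hkl : k ≤ l) :
    (l.choose k : ℝ) * c ^ k * (D - δ) ^ (l - k) / D ^ l ≤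
      (c * Real.exp 1 / δ) ^ k * ((δ * (l / D)) ^ k * Real.exp (-(δ * (l / D)))) := by
  have hD0 : 0 < D := hδ.trans_le hD
  have hbase : (D - δ) / D ≤ Real.exp (-(δ / D)) := by
    rw [sub_div, div_self hD0.ne']
    exact Real.one_sub_le_exp_neg _
  have hpow : ((D - δ) / D) ^ (l - k) ≤ Real.exp 1 ^ k * Real.exp (-(δ * (l / D))) := by
    refine (pow_le_pow_left₀ (div_nonneg (by linarith) hD0.le) hbase _).trans ?_
    rw [← Real.exp_nat_mul, ← Real.exp_nat_mul, ← Real.exp_add, Real.exp_le_exp,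
      Nat.cast_sub hkl]
    have : (k : ℝ) * (δ / D) ≤ k * 1 := by
      gcongr
      exact (div_le_one hD0).2 hD
    have e : ((l : ℝ) - k) * -(δ / D) = k * (δ / D) - δ * (l / D) := by ring
    linarith
  have hchoose : (l.choose k : ℝ) ≤ (l : ℝ) ^ k := by exact_mod_cast Nat.choose_le_pow l k
  have hsplit : D ^ l = D ^ k * D ^ (l - k) := by rw [← pow_add, Nat.add_sub_cancel' hkl]
  calc _ = (l.choose k : ℝ) * (c ^ k / D ^ k) * ((D - δ) / D) ^ (l - k) := by
        rw [hsplit, div_pow]; field_simp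
    _ ≤ (l : ℝ) ^ k * (c ^ k / D ^ k) * (Real.exp 1 ^ k * Real.exp (-(δ * (l / D)))) := by
        have : 0 ≤ (D - δ) / D := div_nonneg (by linarith) hD0.le
        gcongr
    _ = _ := by
        simp only [mul_pow, div_pow]
        field_simp

theorem tendsto_choose_mul_pow_div_pow {ι : Type*} {f : Filter ι} {D : ι → ℝ} {l : ι → ℕ}
    {c δ : ℝ} (hc : 0 ≤ c) (hδ : 0 < δ) (hD : ∀ᶠ i in f, δ ≤ D i)
    (hl : Tendsto (fun i => (l i : ℝ) / D i) f atTop) (k : ℕ) :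
    Tendsto (fun i => ((l i).choose k : ℝ) * c ^ k * (D i - δ) ^ (l i - k) / D i ^ l i) f
      (nhds 0) := by
  have hlim : Tendsto (fun i => (c * Real.exp 1 / δ) ^ k *
      ((δ * (l i / D i)) ^ k * Real.exp (-(δ * (l i / D i))))) f (nhds 0) := by
    have := (((Real.tendsto_pow_mul_exp_neg_atTop_nhds_zero k).comp
      (hl.const_mul_atTop hδ))).const_mul ((c * Real.exp 1 / δ) ^ k)
    simpa [Function.comp_def] using this
  refine squeeze_zero' ?_ ?_ hlim
  · filter_upwards [hD] with i hi
    have : 0 ≤ D i - δ := by linarith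
    have : 0 < D i := by linarith
    positivity
  · filter_upwards [hD] with i hi
    rcases le_or_gt k (l i) with h | h
    · exact choose_mul_pow_div_pow_le hc hδ hi h
    · have : 0 < D i := by linarith
      rw [Nat.choose_eq_zero_of_lt h]
      simp only [Nat.cast_zero, zero_mul, zero_div]
      positivity

theorem dcot_div_dtot_eq {α θ : ℝ} (hα0 : 0 < α) (hα1 : α < 1) (hθ : -α < θ) {n m : ℕ}
    (hn : 1 ≤ n) (h : n ≤ m) (k l : ℕ) :
    dcot α θ n k m l / dtot α θ m l =
      (l.choose k : ℝ) * (risingFac (θ + 1) (n - 1))⁻¹ ^ k *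
        ((risingRatio α θ m - θ) / α - (risingRatio α θ n - θ) / α) ^ (l - k) /
          ((risingRatio α θ m - θ) / α) ^ l := by
  rcases lt_or_ge l k with hlk | hkl
  · simp [dcot, Nat.choose_eq_zero_of_lt hlk]
  have hθ1 : 0 < θ + 1 := by linarith
  have hP := risingFac_pos hθ1 (m - 1)
  have hr : risingFac (θ + n) (m - n) =
      risingFac (θ + 1) (m - 1) * (risingFac (θ + 1) (n - 1))⁻¹ := by
    rw [eq_mul_inv_iff_mul_eq₀ (risingFac_pos hθ1 _).ne', show m - 1 = n - 1 + (m - n) by omega,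
      risingFac_add, Nat.cast_sub hn, mul_comm]
    congr 2
    push_cast
    ring
  have hT : risingFac (θ + 1) (m - 1) + Scot α θ 1 m =
      risingFac (θ + 1) (m - 1) * ((risingRatio α θ m - θ) / α) := by
    rw [Scot_eq hα0 hα1 hθ le_rfl (hn.trans h), risingRatio_one]
    field_simp
    ring
  rw [dcot, dtot, hT, hr, Scot_eq hα0 hα1 hθ hn h, ← sub_div, sub_sub_sub_cancel_right]
  simp only [mul_pow (risingFac (θ + 1) (m - 1))]
  conv_lhs => rw [show risingFac (θ + 1) (m - 1) ^ l = risingFac (θ + 1) (m - 1) ^ k *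
    risingFac (θ + 1) (m - 1) ^ (l - k) by rw [← pow_add, Nat.add_sub_cancel' hkl]]
  rw [← mul_div_mul_left _ (((risingRatio α θ m - θ) / α) ^ l)
    (mul_pos (pow_pos hP k) (pow_pos hP (l - k))).ne']
  congr 1
  ring

/-- Key claim in the proof of Proposition 2.3(c): paths with superpolynomial
feature growth force the cotransition ratio to vanish. -/
theorem stmt_19
    (α θ : ℝ) (hα0 : 0 < α) (hα1 : α < 1) (hθ : -α < θ)
    (ω : ℕ → ℕ)
    (hω : Tendsto (fun m : ℕ => (ω m : ℝ) / (m : ℝ) ^ α) atTop atTop) :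
    ∀ n : ℕ, 1 ≤ n → ∀ k : ℕ,
      Tendsto (fun m : ℕ => dcot α θ n k m (ω m) / dtot α θ m (ω m)) atTop
        (nhds 0) := by
  intro n hn k
  have hδ : 0 < (risingRatio α θ n - θ) / α := by
    have := risingRatio_mono hα0 hα1 hθ le_rfl hn
    rw [risingRatio_one] at this
    exact div_pos (by linarith) hα0
  have hle : ∀ᶠ m : ℕ in atTop,
      (risingRatio α θ n - θ) / α ≤ (risingRatio α θ m - θ) / α := by
    filter_upwards [eventually_ge_atTop n] with m hm
    have := risingRatio_mono hα0 hα1 hθ hn hm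
    gcongr
  obtain ⟨C, hC, hCle⟩ := exists_risingRatio_le hα0 hα1 hθ
  have hl : Tendsto (fun m : ℕ => (ω m : ℝ) / ((risingRatio α θ m - θ) / α)) atTop atTop := by
    refine tendsto_atTop_mono' _ ?_ (hω.const_mul_atTop (r := ((C + |θ|) / α)⁻¹) (by positivity))
    filter_upwards [hle, eventually_ge_atTop 1] with m hm hm1
    have hm' : (1 : ℝ) ≤ m := by exact_mod_cast hm1
    have hpow : 1 ≤ (m : ℝ) ^ α := Real.one_le_rpow hm' hα0.le
    have hD : (risingRatio α θ m - θ) / α ≤ (C + |θ|) / α * (m : ℝ) ^ α := by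
      rw [div_mul_eq_mul_div]
      gcongr
      nlinarith [hCle m hm1, neg_abs_le θ, abs_nonneg θ]
    calc _ = (ω m : ℝ) / ((C + |θ|) / α * (m : ℝ) ^ α) := by field_simp
      _ ≤ _ := div_le_div_of_nonneg_left (by positivity) (hδ.trans_le hm) hD
  refine (tendsto_choose_mul_pow_div_pow (c := (risingFac (θ + 1) (n - 1))⁻¹)
    (inv_nonneg.2 (risingFac_pos (by linarith) _).le) hδ hle hl k).congr' ?_
  filter_upwards [eventually_ge_atTop n] with m hm
  exact (dcot_div_dtot_eq hα0 hα1 hθ hn hm k (ω m)).symm
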